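/- Under Assumption 2.3 (with z_{v₀,e₀} and z_{v₁,e₀} finite), for every γ ∈ ℝ one has E_{Π^{γφ}}[H] = γ/4, where H(x) := (1/4)·log(x_{v₁}/x_{v₀}); equivalently, ∫_{Ω_{e₀}} H(Ξ^{γφ}(x)) ℙ_{v₀,v₁,e₀}(dx) = γ/4. -/

import Mathlib

open MeasureTheory
open scoped ENNReal Classical

namespace ERRWGraph

noncomputable section

variable {V : Type*} [Fintype V] [DecidableEq V]

/-- The measure `dx/x` on `(0,∞)`, i.e. Lebesgue measure on a logarithmic scale. -/
def logMeasure : Measure ℝ :=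
  (volume.restrict (Set.Ioi (0 : ℝ))).withDensity fun x => ENNReal.ofReal (1 / x)

variable (G : SimpleGraph V) [Fintype G.edgeSet]

/-- The set `Ω_{e₀}` of strictly positive edge weights normalized at the reference
edge `e₀`. -/
def Omega (e₀ : G.edgeSet) : Set (G.edgeSet → ℝ) :=
  {x | (∀ e, 0 < x e) ∧ x e₀ = 1}

/-- The reference measure `ρ_{e₀} = δ₁(dx_{e₀}) ∏_{e ≠ e₀} dx_e/x_e`, realized as a
measure on `(0,∞)^E ⊆ ℝ^E` concentrated on `Ω_{e₀}`. -/
def rho (e₀ : G.edgeSet) : Measure (G.edgeSet → ℝ) :=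
  Measure.pi fun e => if e = e₀ then Measure.dirac 1 else logMeasure

/-- Vertex weight `x_v = ∑_{e ∋ v} x_e`. -/
def vwt (x : G.edgeSet → ℝ) (v : V) : ℝ :=
  ∑ e : G.edgeSet, if v ∈ (e : Sym2 V) then x e else 0

/-- Vertex weight `a_v = ∑_{e ∋ v} a_e` of the initial weights `a : Sym2 V → ℝ`. -/
def avwt (a : Sym2 V → ℝ) (v : V) : ℝ :=
  ∑ e : G.edgeSet, if v ∈ (e : Sym2 V) then a (e : Sym2 V) else 0

/-- A set `T` of edges of `G` is a spanning tree iff the graph with edge set `T`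
is a tree (i.e. a maximal connected acyclic subgraph of `G`). -/
def IsSpanningTree (T : Finset G.edgeSet) : Prop :=
  (SimpleGraph.fromEdgeSet (Subtype.val '' (T : Set G.edgeSet))).IsTree

/-- `∑_{T ∈ 𝒯} ∏_{e ∈ T} x_e`, the sum over spanning trees of `G`. -/
def treeSum (x : G.edgeSet → ℝ) : ℝ :=
  ∑ T : Finset G.edgeSet, if IsSpanningTree G T then (∏ e ∈ T, x e) else 0

/-- The function `Φ_{v₀,a}` from the Coppersmith–Diaconis description of the
mixing measure. -/
def Phi (a : Sym2 V → ℝ) (v₀ : V) (x : G.edgeSet → ℝ) : ℝ :=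
  (∏ e : G.edgeSet, x e ^ a (e : Sym2 V)) * vwt G x v₀ ^ (-avwt G a v₀ / 2) *
    (∏ v ∈ Finset.univ.erase v₀, vwt G x v ^ (-(avwt G a v + 1) / 2)) *
    Real.sqrt (treeSum G x)

/-- The normalizing constant `z_{v₀,e₀} = ∫ Φ_{v₀,a} dρ_{e₀}`. -/
def z (a : Sym2 V → ℝ) (v₀ : V) (e₀ : G.edgeSet) : ℝ≥0∞ :=
  ∫⁻ x, ENNReal.ofReal (Phi G a v₀ x) ∂rho G e₀

/-- The mixing measure `ℚ_{v₀,e₀}`, with density `Φ_{v₀,a}/z_{v₀,e₀}` w.r.t. `ρ_{e₀}`. -/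
def Qm (a : Sym2 V → ℝ) (v₀ : V) (e₀ : G.edgeSet) : Measure (G.edgeSet → ℝ) :=
  (z G a v₀ e₀)⁻¹ • (rho G e₀).withDensity fun x => ENNReal.ofReal (Phi G a v₀ x)

/-- The density `((Φ_{v₀,a}/z_{v₀,e₀})·(Φ_{v₁,a}/z_{v₁,e₀}))^{1/2}` of the
interpolated measure. -/
def interpDens (a : Sym2 V → ℝ) (v₀ v₁ : V) (e₀ : G.edgeSet) (x : G.edgeSet → ℝ) : ℝ≥0∞ :=
  (ENNReal.ofReal (Phi G a v₀ x) / z G a v₀ e₀ *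
    (ENNReal.ofReal (Phi G a v₁ x) / z G a v₁ e₀)) ^ (1 / 2 : ℝ)

/-- The normalizing constant `Z_{v₀,v₁,e₀}` of the interpolated measure. -/
def Zc (a : Sym2 V → ℝ) (v₀ v₁ : V) (e₀ : G.edgeSet) : ℝ≥0∞ :=
  ∫⁻ x, interpDens G a v₀ v₁ e₀ x ∂rho G e₀

/-- The interpolated measure `ℙ_{v₀,v₁,e₀}`. -/
def Pm (a : Sym2 V → ℝ) (v₀ v₁ : V) (e₀ : G.edgeSet) : Measure (G.edgeSet → ℝ) :=
  (Zc G a v₀ v₁ e₀)⁻¹ • (rho G e₀).withDensity (interpDens G a v₀ v₁ e₀)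

/-- `f` is an automorphism of the weighted graph `(G,a)`. -/
def IsAut (a : Sym2 V → ℝ) (f : V → V) : Prop :=
  Function.Bijective f ∧ (∀ u v : V, G.Adj (f u) (f v) ↔ G.Adj u v) ∧
    ∀ u v : V, G.Adj u v → a s(f u, f v) = a s(u, v)

/-- Assumption 2.3 of the paper. -/
def Assumption23 (a φ : Sym2 V → ℝ) (v₀ v₁ : V) (e₀ : G.edgeSet) : Prop :=
  v₀ ≠ v₁ ∧ ¬G.Adj v₀ v₁ ∧ v₀ ∈ (e₀ : Sym2 V) ∧
    (∃ f : V → V, IsAut G a f ∧ f v₀ = v₁ ∧ f v₁ = v₀) ∧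
    (∀ e : G.edgeSet, φ (e : Sym2 V) ∈ Set.Icc (0 : ℝ) 1) ∧
    (∀ e : G.edgeSet, v₀ ∈ (e : Sym2 V) → φ (e : Sym2 V) = 0) ∧
    (∀ e : G.edgeSet, v₁ ∈ (e : Sym2 V) → φ (e : Sym2 V) = 1)

/-- `max_{e,e' ∋ v} (φ(e) - φ(e'))²`. -/
def maxsq (φ : Sym2 V → ℝ) (v : V) : ℝ :=
  sSup ((fun p : G.edgeSet × G.edgeSet =>
      (φ (p.1 : Sym2 V) - φ (p.2 : Sym2 V)) ^ 2) ''
    {p : G.edgeSet × G.edgeSet | v ∈ (p.1 : Sym2 V) ∧ v ∈ (p.2 : Sym2 V)})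

/-- The "Dirichlet form" `S_φ`. -/
def Sphi (a φ : Sym2 V → ℝ) : ℝ :=
  ∑ v : V, (avwt G a v + 1) / 2 * maxsq G φ v

/-- `H_{v₀,v₁}(x) = (1/4) log (x_{v₁}/x_{v₀})`. -/
def Hfun (v₀ v₁ : V) (x : G.edgeSet → ℝ) : ℝ :=
  (1 / 4) * Real.log (vwt G x v₁ / vwt G x v₀)

/-- `log (dQ/dP)` realized via the Radon–Nikodym derivative. -/
def logRN {α : Type*} [MeasurableSpace α] (Q P : Measure α) (x : α) : ℝ :=
  Real.log ((Q.rnDeriv P x).toReal)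

/-- The deformation map `Ξ^{γφ}(x) = (e^{γφ(e)} x_e)_{e∈E}`. -/
def Xi (φ : Sym2 V → ℝ) (γ : ℝ) (x : G.edgeSet → ℝ) : G.edgeSet → ℝ :=
  fun e => Real.exp (γ * φ (e : Sym2 V)) * x e

/-- `Π^{γφ}`, the image of `ℙ_{v₀,v₁,e₀}` under `Ξ^{γφ}`. -/
def PiGamma (a φ : Sym2 V → ℝ) (v₀ v₁ : V) (e₀ : G.edgeSet) (γ : ℝ) :
    Measure (G.edgeSet → ℝ) :=
  Measure.map (Xi G φ γ) (Pm G a v₀ v₁ e₀)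

/-- The explicit realization `f_γ` of `log(dΠ^{γφ}/dℙ_{v₀,v₁,e₀}) ∘ Ξ^{γφ}`. -/
def fgamma (a φ : Sym2 V → ℝ) (v₀ v₁ : V) (γ : ℝ) (x : G.edgeSet → ℝ) : ℝ :=
  γ * (avwt G a v₁ / 2 + 1 / 4) -
    γ * ∑ e : G.edgeSet, φ (e : Sym2 V) * a (e : Sym2 V) +
    (∑ v ∈ Finset.univ \ {v₀, v₁}, (avwt G a v + 1) / 2 *
      Real.log (vwt G (Xi G φ γ x) v / vwt G x v)) -
    (1 / 2) * Real.log (treeSum G (Xi G φ γ x) / treeSum G x)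

/-- Mean of `φ` under the measure `μ_{x,v,γ}` on the edges incident to `v`. -/
def muMean (φ : Sym2 V → ℝ) (γ : ℝ) (x : G.edgeSet → ℝ) (v : V) : ℝ :=
  (∑ e : G.edgeSet, if v ∈ (e : Sym2 V) then φ (e : Sym2 V) * Xi G φ γ x e else 0) /
    vwt G (Xi G φ γ x) v

/-- Variance of `φ` under `μ_{x,v,γ}`. -/
def muVar (φ : Sym2 V → ℝ) (γ : ℝ) (x : G.edgeSet → ℝ) (v : V) : ℝ :=
  (∑ e : G.edgeSet, if v ∈ (e : Sym2 V) then
      (φ (e : Sym2 V) - muMean G φ γ x v) ^ 2 * Xi G φ γ x e else 0) /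
    vwt G (Xi G φ γ x) v

/-- `Δ(T) = ∑_{e ∈ T} φ(e)`. -/
def Delta (φ : Sym2 V → ℝ) (T : Finset G.edgeSet) : ℝ := ∑ e ∈ T, φ (e : Sym2 V)

/-- Mean of `Δ` under the measure `ν_{x,γ}` on spanning trees. -/
def nuMean (φ : Sym2 V → ℝ) (γ : ℝ) (x : G.edgeSet → ℝ) : ℝ :=
  (∑ T : Finset G.edgeSet, if IsSpanningTree G T then
      Delta G φ T * ∏ e ∈ T, Xi G φ γ x e else 0) /
    treeSum G (Xi G φ γ x)

/-- Variance of `Δ` under `ν_{x,γ}`. -/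
def nuVar (φ : Sym2 V → ℝ) (γ : ℝ) (x : G.edgeSet → ℝ) : ℝ :=
  (∑ T : Finset G.edgeSet, if IsSpanningTree G T then
      (Delta G φ T - nuMean G φ γ x) ^ 2 * ∏ e ∈ T, Xi G φ γ x e else 0) /
    treeSum G (Xi G φ γ x)

/-- The claimed first derivative of `γ ↦ f_γ(x)`. -/
def fder1 (a φ : Sym2 V → ℝ) (v₀ v₁ : V) (x : G.edgeSet → ℝ) (γ : ℝ) : ℝ :=
  avwt G a v₁ / 2 + 1 / 4 - (∑ e : G.edgeSet, φ (e : Sym2 V) * a (e : Sym2 V)) +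
    (∑ v ∈ Finset.univ \ {v₀, v₁}, (avwt G a v + 1) / 2 * muMean G φ γ x v) -
    (1 / 2) * nuMean G φ γ x

/-- The claimed second derivative of `γ ↦ f_γ(x)`. -/
def fder2 (a φ : Sym2 V → ℝ) (v₀ v₁ : V) (x : G.edgeSet → ℝ) (γ : ℝ) : ℝ :=
  (∑ v ∈ Finset.univ \ {v₀, v₁}, (avwt G a v + 1) / 2 * muVar G φ γ x v) -
    (1 / 2) * nuVar G φ γ x

/-- Membership in the class `𝒫` of the variational principle. -/
def VarP (a : Sym2 V → ℝ) (v₀ v₁ : V) (e₀ : G.edgeSet)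
    (Q : Measure (G.edgeSet → ℝ)) : Prop :=
  IsProbabilityMeasure Q ∧ Q ≪ Pm G a v₀ v₁ e₀ ∧ Pm G a v₀ v₁ e₀ ≪ Q ∧
    Integrable (Hfun G v₀ v₁) Q ∧ Integrable (logRN Q (Pm G a v₀ v₁ e₀)) Q

/-- The functional `F(Π) = E_Π[H] + E_Π[log(dΠ/dℙ_{v₀,v₁,e₀})]`. -/
def Ffun (a : Sym2 V → ℝ) (v₀ v₁ : V) (e₀ : G.edgeSet)
    (Q : Measure (G.edgeSet → ℝ)) : ℝ :=
  (∫ x, Hfun G v₀ v₁ x ∂Q) + ∫ x, logRN Q (Pm G a v₀ v₁ e₀) x ∂Q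

end

end ERRWGraph

namespace ERRWGraph

section LogScale

instance : SigmaFinite logMeasure := SigmaFinite.withDensity_ofReal _

theorem logMeasure_apply {s : Set ℝ} (hs : MeasurableSet s) :
    logMeasure s =
      ∫⁻ x, (s ∩ Set.Ioi 0).indicator (fun x => ENNReal.ofReal (1 / x)) x := by
  rw [logMeasure, withDensity_apply _ hs, Measure.restrict_restrict hs,
    lintegral_indicator (hs.inter measurableSet_Ioi)]

theorem logMeasure_preimage_mul {t : ℝ} (ht : 0 < t) {s : Set ℝ} (hs : MeasurableSet s) :
    logMeasure ((fun y => t * y) ⁻¹' s) = logMeasure s := by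
  have hm : Measurable ((s ∩ Set.Ioi 0).indicator fun x : ℝ => ENNReal.ofReal (1 / x)) :=
    Measurable.indicator (by fun_prop) (hs.inter measurableSet_Ioi)
  rw [logMeasure_apply (hs.preimage (measurable_const_mul t)), logMeasure_apply hs]
  conv_rhs => rw [← Real.smul_map_volume_mul_left ht.ne', lintegral_smul_measure,
    lintegral_map hm (measurable_const_mul t), smul_eq_mul,
    ← lintegral_const_mul _ (by exact hm.comp (measurable_const_mul t))]
  refine lintegral_congr fun y => ?_
  by_cases hy : t * y ∈ s ∧ 0 < y
  · rw [Set.indicator_of_mem (by simpa using hy),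
      Set.indicator_of_mem (by simpa [ht] using hy), ← ENNReal.ofReal_mul (abs_nonneg _),
      abs_of_pos ht]
    congr 1
    have := hy.2
    field_simp
  · rw [Set.indicator_of_notMem (by simpa using hy),
      Set.indicator_of_notMem (by simpa [ht] using hy), mul_zero]

theorem ae_pos_logMeasure : ∀ᵐ x ∂logMeasure, 0 < x := by
  rw [logMeasure]
  exact (withDensity_absolutelyContinuous _ _) (ae_restrict_mem measurableSet_Ioi)

theorem logMeasure_Icc_ne_zero : logMeasure (Set.Icc 1 2) ≠ 0 := by
  rw [logMeasure, withDensity_apply _ measurableSet_Icc,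
    Measure.restrict_restrict measurableSet_Icc,
    Set.inter_eq_left.2 (Set.Icc_subset_Ioi_iff one_le_two |>.2 one_pos)]
  have h : ∫⁻ _ in Set.Icc (1 : ℝ) 2, ENNReal.ofReal (1 / 2) ≤
      ∫⁻ x in Set.Icc (1 : ℝ) 2, ENNReal.ofReal (1 / x) :=
    setLIntegral_mono' measurableSet_Icc fun x hx =>
      ENNReal.ofReal_le_ofReal (one_div_le_one_div_of_le (by linarith [hx.1]) hx.2)
  refine (lt_of_lt_of_le ?_ h).ne'
  norm_num [setLIntegral_const]

theorem logMeasure_Icc_ne_top : logMeasure (Set.Icc 1 2) ≠ ⊤ := by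
  rw [logMeasure, withDensity_apply _ measurableSet_Icc,
    Measure.restrict_restrict measurableSet_Icc,
    Set.inter_eq_left.2 (Set.Icc_subset_Ioi_iff one_le_two |>.2 one_pos)]
  have h : ∫⁻ x in Set.Icc (1 : ℝ) 2, ENNReal.ofReal (1 / x) ≤
      ∫⁻ _ in Set.Icc (1 : ℝ) 2, ENNReal.ofReal 1 :=
    setLIntegral_mono' measurableSet_Icc fun x hx =>
      ENNReal.ofReal_le_ofReal ((div_le_one (by linarith [hx.1])).2 hx.1)
  refine (lt_of_le_of_lt h ?_).ne
  norm_num [setLIntegral_const]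

/-- The product of logarithmic measures with the coordinate `i` replaced by a point mass
at `1`. -/
noncomputable def normMeasure {ι : Type*} [Fintype ι] [DecidableEq ι] (i : ι) :
    Measure (ι → ℝ) :=
  Measure.pi fun e => if e = i then Measure.dirac 1 else logMeasure

variable {ι : Type*} [Fintype ι] [DecidableEq ι]

instance (i e : ι) : SigmaFinite (if e = i then Measure.dirac 1 else logMeasure) := by
  split_ifs <;> infer_instance

instance (i : ι) : SigmaFinite (normMeasure i) := by
  unfold normMeasure; infer_instance

theorem ae_pos_normMeasure (i : ι) : ∀ᵐ x ∂normMeasure i, ∀ e, 0 < x e := by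
  rw [ae_all_iff]
  intro e
  refine (Measure.tendsto_eval_ae_ae (i := e)).eventually
    (p := fun y : ℝ => 0 < y) ?_
  split_ifs
  · rw [ae_dirac_iff measurableSet_Ioi]; exact one_pos
  · exact ae_pos_logMeasure

theorem normMeasure_ne_zero (i : ι) : normMeasure i ≠ 0 := by
  intro h
  have h1 : normMeasure i (Set.univ.pi fun _ => Set.Icc 1 2) = 0 := by rw [h]; rfl
  rw [normMeasure, Measure.pi_pi, Finset.prod_eq_zero_iff] at h1
  obtain ⟨e, -, he⟩ := h1
  split_ifs at he
  · simp at he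
  · exact logMeasure_Icc_ne_zero he

/-- Polar decomposition of the product of logarithmic measures. -/
theorem map_smul_logMeasure_prod (i : ι) :
    Measure.map (fun p : ℝ × (ι → ℝ) => fun e => p.1 * p.2 e) (logMeasure.prod (normMeasure i)) =
      Measure.pi fun _ => logMeasure := by
  symm
  have hm : Measurable fun p : ℝ × (ι → ℝ) => fun e => p.1 * p.2 e := by fun_prop
  refine Measure.pi_eq fun s hs => ?_
  rw [Measure.map_apply hm (MeasurableSet.univ_pi hs),
    Measure.prod_apply (hm (MeasurableSet.univ_pi hs)),
    ← Finset.mul_prod_erase _ _ (Finset.mem_univ i)]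
  have key : ∀ᵐ t ∂logMeasure, normMeasure i (Prod.mk t ⁻¹'
      ((fun p : ℝ × (ι → ℝ) => fun e => p.1 * p.2 e) ⁻¹' Set.univ.pi s)) =
      (s i).indicator (fun _ => ∏ e ∈ Finset.univ.erase i, logMeasure (s e)) t := by
    filter_upwards [ae_pos_logMeasure] with t ht
    have : (Prod.mk t ⁻¹'
      ((fun p : ℝ × (ι → ℝ) => fun e => p.1 * p.2 e) ⁻¹' Set.univ.pi s)) =
        Set.univ.pi fun e => (fun y => t * y) ⁻¹' s e := by
      ext; simp
    rw [this, normMeasure, Measure.pi_pi, ← Finset.mul_prod_erase _ _ (Finset.mem_univ i),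
      if_pos rfl, Measure.dirac_apply' _ ((hs i).preimage (measurable_const_mul t))]
    rw [Finset.prod_congr rfl fun e he => by
      rw [if_neg (Finset.ne_of_mem_erase he), logMeasure_preimage_mul ht (hs e)]]
    by_cases h : t ∈ s i <;> simp [h]
  rw [lintegral_congr_ae key, lintegral_indicator (hs i), setLIntegral_const, mul_comm]

/-- Integrals of functions that are homogeneous of degree zero do not depend on the
normalized coordinate. -/
theorem lintegral_normMeasure_eq {F : (ι → ℝ) → ℝ≥0∞} (hF : Measurable F)
    (hom : ∀ t : ℝ, 0 < t → ∀ x : ι → ℝ, (∀ e, 0 < x e) → F (fun e => t * x e) = F x)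
    (i j : ι) : ∫⁻ x, F x ∂normMeasure i = ∫⁻ x, F x ∂normMeasure j := by
  have main : ∀ k : ι, ∫⁻ y, F y * (Set.Icc (1 : ℝ) 2).indicator 1 (y j)
      ∂(Measure.pi fun _ => logMeasure) =
      (∫⁻ x, F x ∂normMeasure k) * logMeasure (Set.Icc 1 2) := by
    intro k
    have hI : Measurable ((Set.Icc (1 : ℝ) 2).indicator (1 : ℝ → ℝ≥0∞)) :=
      measurable_one.indicator measurableSet_Icc
    have hG : Measurable fun y : ι → ℝ => F y * (Set.Icc (1 : ℝ) 2).indicator 1 (y j) :=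
      hF.mul (hI.comp (measurable_pi_apply j))
    have hm : Measurable fun p : ℝ × (ι → ℝ) => fun e => p.1 * p.2 e := by fun_prop
    rw [← map_smul_logMeasure_prod k, lintegral_map hG hm,
      lintegral_prod_symm _ (by exact (hG.comp hm).aemeasurable), ← lintegral_mul_const _ hF]
    refine lintegral_congr_ae ?_
    filter_upwards [ae_pos_normMeasure k] with x hx
    have : ∀ᵐ t ∂logMeasure, F (fun e => t * x e) *
        (Set.Icc (1 : ℝ) 2).indicator 1 (t * x j) =
        F x * ((fun y => x j * y) ⁻¹' Set.Icc (1 : ℝ) 2).indicator 1 t := by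
      filter_upwards [ae_pos_logMeasure] with t ht
      rw [hom t ht x hx, mul_comm t]
      rfl
    have hs : MeasurableSet ((fun y => x j * y) ⁻¹' Set.Icc (1 : ℝ) 2) :=
      measurableSet_Icc.preimage (measurable_const_mul _)
    rw [lintegral_congr_ae this, lintegral_const_mul _ (measurable_one.indicator hs),
      lintegral_indicator_one hs, logMeasure_preimage_mul (hx j) measurableSet_Icc]
  exact (ENNReal.mul_left_inj logMeasure_Icc_ne_zero logMeasure_Icc_ne_top).1
    ((main i).symm.trans (main j))

theorem map_comp_normMeasure (σ : ι ≃ ι) (i : ι) :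
    Measure.map (fun x : ι → ℝ => x ∘ σ) (normMeasure i) = normMeasure (σ.symm i) := by
  have hm : Measurable fun x : ι → ℝ => x ∘ σ := by
    refine measurable_pi_lambda _ fun e => measurable_pi_apply _
  symm
  refine Measure.pi_eq fun s hs => ?_
  have : (fun x : ι → ℝ => x ∘ σ) ⁻¹' Set.univ.pi s = Set.univ.pi fun e => s (σ.symm e) := by
    ext x
    simp only [Set.mem_preimage, Set.mem_univ_pi, Function.comp_apply]
    exact ⟨fun h e => by simpa using h (σ.symm e), fun h e => by simpa using h (σ e)⟩
  rw [Measure.map_apply hm (MeasurableSet.univ_pi hs), this, normMeasure, Measure.pi_pi,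
    ← Equiv.prod_comp σ]
  simp [Equiv.eq_symm_apply]

theorem lintegral_normMeasure_comp {F : (ι → ℝ) → ℝ≥0∞} (hF : Measurable F)
    (hom : ∀ t : ℝ, 0 < t → ∀ x : ι → ℝ, (∀ e, 0 < x e) → F (fun e => t * x e) = F x)
    (σ : ι ≃ ι) (i : ι) : ∫⁻ x, F (x ∘ σ) ∂normMeasure i = ∫⁻ x, F x ∂normMeasure i := by
  have hm : Measurable fun x : ι → ℝ => x ∘ σ :=
    measurable_pi_lambda _ fun e => measurable_pi_apply _
  rw [← lintegral_map hF hm, map_comp_normMeasure, lintegral_normMeasure_eq hF hom _ i]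

end LogScale

section Weights

variable {V : Type*} {G : SimpleGraph V}

theorem card_isSpanningTree [Fintype V] {T : Finset G.edgeSet} (hT : IsSpanningTree G T) :
    T.card + 1 = Fintype.card V := by
  have h := (SimpleGraph.isTree_iff_connected_and_card.1 hT).2
  rw [SimpleGraph.edgeSet_fromEdgeSet, Nat.card_eq_fintype_card (α := V)] at h
  rw [← h, sdiff_eq_left.2]
  · rw [Nat.card_image_of_injective Subtype.val_injective]
    simp
  · rw [Set.disjoint_left]
    rintro _ ⟨e, -, rfl⟩
    exact G.not_isDiag_of_mem_edgeSet e.2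

theorem isSpanningTree_map (ψ : G ≃g G) (T : Finset G.edgeSet) :
    IsSpanningTree G (T.map ψ.mapEdgeSet.toEmbedding) ↔ IsSpanningTree G T := by
  refine (SimpleGraph.Iso.isTree_iff ⟨ψ.toEquiv, ?_⟩).symm
  intro u w
  simp only [SimpleGraph.fromEdgeSet_adj, ne_eq, EmbeddingLike.apply_eq_iff_eq]
  refine and_congr_left fun _ => ?_
  have hval : ∀ e : G.edgeSet, (ψ.mapEdgeSet e : Sym2 V) = Sym2.map ψ e := fun _ => rfl
  constructor
  · rintro ⟨e, he, h⟩
    simp only [Finset.coe_map, Set.mem_image, Finset.mem_coe] at he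
    obtain ⟨e', he', rfl⟩ := he
    refine ⟨e', he', Sym2.map.injective ψ.injective ?_⟩
    exact h
  · rintro ⟨e, he, h⟩
    refine ⟨ψ.mapEdgeSet e, by rw [Finset.coe_map]; exact Set.mem_image_of_mem _ he, ?_⟩
    rw [hval, h]
    rfl

variable [Fintype G.edgeSet]

theorem exists_isSpanningTree (hG : G.Connected) : ∃ T, IsSpanningTree G T := by
  obtain ⟨F, hF, hT⟩ := hG.exists_isTree_le
  refine ⟨Finset.univ.filter fun e => (e : Sym2 V) ∈ F.edgeSet, ?_⟩
  have : Subtype.val '' ((Finset.univ.filter fun e : G.edgeSet =>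
      (e : Sym2 V) ∈ F.edgeSet : Finset G.edgeSet) : Set G.edgeSet) = F.edgeSet := by
    ext e
    simp only [Finset.coe_filter, Finset.mem_univ, true_and, Set.mem_image, Set.mem_ofPred_eq]
    exact ⟨fun ⟨e', h, h'⟩ => h' ▸ h,
      fun h => ⟨⟨e, SimpleGraph.edgeSet_subset_edgeSet.2 hF h⟩, h, rfl⟩⟩
  rw [IsSpanningTree, this, SimpleGraph.fromEdgeSet_edgeSet]
  exact hT

theorem treeSum_pos (hG : G.Connected) {x : G.edgeSet → ℝ} (hx : ∀ e, 0 < x e) :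
    0 < treeSum G x := by
  obtain ⟨T, hT⟩ := exists_isSpanningTree hG
  refine Finset.sum_pos' (fun S _ => ?_) ⟨T, Finset.mem_univ _, ?_⟩
  · split_ifs
    exacts [Finset.prod_nonneg fun e _ => (hx e).le, le_rfl]
  · rw [if_pos hT]
    exact Finset.prod_pos fun e _ => hx e

theorem treeSum_comp (ψ : G ≃g G) (x : G.edgeSet → ℝ) :
    treeSum G (x ∘ ψ.mapEdgeSet) = treeSum G x := by
  rw [treeSum, treeSum]
  refine Eq.trans ?_ (Equiv.sum_comp ψ.mapEdgeSet.finsetCongr _)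
  refine Finset.sum_congr rfl fun T _ => ?_
  rw [Equiv.finsetCongr_apply]
  simp only [isSpanningTree_map, Finset.prod_map, Equiv.coe_toEmbedding, Function.comp_apply]

theorem treeSum_smul [Fintype V] (t : ℝ) (x : G.edgeSet → ℝ) :
    treeSum G (fun e => t * x e) = t ^ (Fintype.card V - 1) * treeSum G x := by
  rw [treeSum, treeSum, Finset.mul_sum]
  refine Finset.sum_congr rfl fun T _ => ?_
  split_ifs with hT
  · rw [Finset.prod_mul_distrib, Finset.prod_const, ← card_isSpanningTree hT,
      Nat.add_sub_cancel]
  · simp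

variable [DecidableEq V]

theorem vwt_pos (hG : G.Connected) [Nontrivial V] {x : G.edgeSet → ℝ} (hx : ∀ e, 0 < x e)
    (v : V) : 0 < vwt G x v := by
  obtain ⟨w, hw⟩ := hG.preconnected.exists_adj_of_nontrivial v
  refine Finset.sum_pos' (fun e _ => ?_) ⟨⟨s(v, w), hw⟩, Finset.mem_univ _, ?_⟩
  · split_ifs
    exacts [(hx e).le, le_rfl]
  · rw [if_pos (Sym2.mem_mk_left v w)]
    exact hx _

theorem vwt_smul (t : ℝ) (x : G.edgeSet → ℝ) (v : V) :
    vwt G (fun e => t * x e) v = t * vwt G x v := by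
  simp [vwt, Finset.mul_sum]

theorem avwt_eq_vwt (a : Sym2 V → ℝ) (v : V) : avwt G a v = vwt G (fun e => a e) v := rfl

theorem vwt_Xi {φ : Sym2 V → ℝ} {v : V} {c : ℝ}
    (hφ : ∀ e : G.edgeSet, v ∈ (e : Sym2 V) → φ e = c) (γ : ℝ) (x : G.edgeSet → ℝ) :
    vwt G (Xi G φ γ x) v = Real.exp (γ * c) * vwt G x v := by
  rw [vwt, vwt, Finset.mul_sum]
  refine Finset.sum_congr rfl fun e _ => ?_
  split_ifs with h
  · rw [Xi, hφ e h]
  · simp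

theorem Hfun_smul {t : ℝ} (ht : 0 < t) (v₀ v₁ : V) (x : G.edgeSet → ℝ) :
    Hfun G v₀ v₁ (fun e => t * x e) = Hfun G v₀ v₁ x := by
  rw [Hfun, Hfun, vwt_smul, vwt_smul, mul_div_mul_left _ _ ht.ne']

theorem Hfun_swap (v₀ v₁ : V) (x : G.edgeSet → ℝ) : Hfun G v₁ v₀ x = -Hfun G v₀ v₁ x := by
  rw [Hfun, Hfun, ← inv_div (vwt G x v₁), Real.log_inv, mul_neg]

theorem Hfun_Xi [Nontrivial V] (hG : G.Connected) {φ : Sym2 V → ℝ} {v₀ v₁ : V}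
    (hφ₀ : ∀ e : G.edgeSet, v₀ ∈ (e : Sym2 V) → φ e = 0)
    (hφ₁ : ∀ e : G.edgeSet, v₁ ∈ (e : Sym2 V) → φ e = 1) (γ : ℝ) {x : G.edgeSet → ℝ}
    (hx : ∀ e, 0 < x e) : Hfun G v₀ v₁ (Xi G φ γ x) = γ / 4 + Hfun G v₀ v₁ x := by
  have h0 := vwt_pos hG hx v₀
  have h1 := vwt_pos hG hx v₁
  rw [Hfun, Hfun, vwt_Xi hφ₀, vwt_Xi hφ₁, mul_zero, Real.exp_zero, one_mul, mul_one,
    mul_div_assoc, Real.log_mul (Real.exp_pos γ).ne' (div_pos h1 h0).ne', Real.log_exp]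
  ring

theorem vwt_comp (ψ : G ≃g G) (x : G.edgeSet → ℝ) (v : V) :
    vwt G (x ∘ ψ.mapEdgeSet) v = vwt G x (ψ v) := by
  rw [vwt, vwt]
  refine Eq.trans ?_ (Equiv.sum_comp ψ.mapEdgeSet _)
  refine Finset.sum_congr rfl fun e _ => ?_
  have : ψ v ∈ (ψ.mapEdgeSet e : Sym2 V) ↔ v ∈ (e : Sym2 V) := by
    change ψ v ∈ Sym2.map ψ (e : Sym2 V) ↔ _
    rw [Sym2.mem_map]
    exact ⟨fun ⟨u, hu, h⟩ => ψ.injective h ▸ hu, fun h => ⟨v, h, rfl⟩⟩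
  simp only [this, Function.comp_apply]

theorem Hfun_comp (ψ : G ≃g G) (v₀ v₁ : V) (x : G.edgeSet → ℝ) :
    Hfun G v₀ v₁ (x ∘ ψ.mapEdgeSet) = Hfun G (ψ v₀) (ψ v₁) x := by
  rw [Hfun, Hfun, vwt_comp, vwt_comp]

variable [Fintype V]

theorem sum_vwt (x : G.edgeSet → ℝ) : ∑ v, vwt G x v = 2 * ∑ e, x e := by
  simp only [vwt]
  rw [Finset.sum_comm, Finset.mul_sum]
  refine Finset.sum_congr rfl fun e _ => ?_
  obtain ⟨e, he⟩ := e
  induction e with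
  | _ u w =>
    have huw : u ≠ w := G.ne_of_adj he
    rw [← Finset.sum_filter]
    have : Finset.univ.filter (fun v => v ∈ s(u, w)) = {u, w} := by
      ext v; simp
    simp only [this]
    rw [Finset.sum_pair huw, two_mul]

theorem Phi_comp (ψ : G ≃g G) {a : Sym2 V → ℝ}
    (ha : ∀ e : G.edgeSet, a (ψ.mapEdgeSet e) = a e) (v : V) (x : G.edgeSet → ℝ) :
    Phi G a v (x ∘ ψ.mapEdgeSet) = Phi G a (ψ v) x := by
  have hav : ∀ u, avwt G a u = avwt G a (ψ u) := fun u => by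
    rw [avwt_eq_vwt, avwt_eq_vwt, ← vwt_comp]
    exact congrArg (vwt G · u) (funext fun e => (ha e).symm)
  have h1 : ∏ e, (x ∘ ψ.mapEdgeSet) e ^ a e = ∏ e, x e ^ a e := by
    rw [← Equiv.prod_comp ψ.mapEdgeSet fun e => x e ^ a e]
    simp only [ha, Function.comp_apply]
  have h2 : ∏ u ∈ Finset.univ.erase v,
      vwt G (x ∘ ψ.mapEdgeSet) u ^ (-(avwt G a u + 1) / 2) =
      ∏ u ∈ Finset.univ.erase (ψ v), vwt G x u ^ (-(avwt G a u + 1) / 2) := by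
    refine Finset.prod_bij (fun u _ => ψ u) ?_ ?_ ?_ ?_
    · simp
    · simp
    · intro b hb
      exact ⟨ψ.symm b, by simpa [RelIso.symm_apply_eq] using hb, by simp⟩
    · intro u _
      rw [vwt_comp, ← hav]
  rw [Phi, Phi, h1, h2, vwt_comp, treeSum_comp, ← hav]

/-- The factor of `Phi` that does not depend on the reference vertex. -/
noncomputable def PhiBase (G : SimpleGraph V) [Fintype G.edgeSet] (a : Sym2 V → ℝ)
    (x : G.edgeSet → ℝ) : ℝ :=
  (∏ e : G.edgeSet, x e ^ a (e : Sym2 V)) *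
    (∏ v, vwt G x v ^ (-(avwt G a v + 1) / 2)) * Real.sqrt (treeSum G x)

variable [Nontrivial V]

theorem Phi_eq (hG : G.Connected) (a : Sym2 V → ℝ) (v : V) {x : G.edgeSet → ℝ}
    (hx : ∀ e, 0 < x e) : Phi G a v x = PhiBase G a x * Real.sqrt (vwt G x v) := by
  have h : vwt G x v ^ (-avwt G a v / 2) =
      vwt G x v ^ (-(avwt G a v + 1) / 2) * Real.sqrt (vwt G x v) := by
    rw [Real.sqrt_eq_rpow, ← Real.rpow_add (vwt_pos hG hx v)]
    congr 1
    ring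
  rw [Phi, PhiBase, h, ← Finset.mul_prod_erase _ _ (Finset.mem_univ v)]
  ring

theorem PhiBase_pos (hG : G.Connected) (a : Sym2 V → ℝ) {x : G.edgeSet → ℝ}
    (hx : ∀ e, 0 < x e) : 0 < PhiBase G a x :=
  mul_pos (mul_pos (Finset.prod_pos fun e _ => Real.rpow_pos_of_pos (hx e) _)
    (Finset.prod_pos fun v _ => Real.rpow_pos_of_pos (vwt_pos hG hx v) _))
    (Real.sqrt_pos.2 (treeSum_pos hG hx))

theorem Phi_pos (hG : G.Connected) (a : Sym2 V → ℝ) (v : V) {x : G.edgeSet → ℝ}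
    (hx : ∀ e, 0 < x e) : 0 < Phi G a v x := by
  rw [Phi_eq hG a v hx]
  exact mul_pos (PhiBase_pos hG a hx) (Real.sqrt_pos.2 (vwt_pos hG hx v))

theorem Phi_smul (hG : G.Connected) (a : Sym2 V → ℝ) (v : V) {x : G.edgeSet → ℝ}
    (hx : ∀ e, 0 < x e) {t : ℝ} (ht : 0 < t) : Phi G a v (fun e => t * x e) = Phi G a v x := by
  have h1 : ∏ e : G.edgeSet, (t * x e) ^ a (e : Sym2 V) =
      t ^ (∑ e : G.edgeSet, a (e : Sym2 V)) * ∏ e : G.edgeSet, x e ^ a (e : Sym2 V) := by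
    rw [Real.rpow_sum_of_pos ht, ← Finset.prod_mul_distrib]
    exact Finset.prod_congr rfl fun e _ => Real.mul_rpow ht.le (hx e).le
  have h2 : ∏ u, (t * vwt G x u) ^ (-(avwt G a u + 1) / 2) =
      t ^ (∑ u, -(avwt G a u + 1) / 2) * ∏ u, vwt G x u ^ (-(avwt G a u + 1) / 2) := by
    rw [Real.rpow_sum_of_pos ht, ← Finset.prod_mul_distrib]
    exact Finset.prod_congr rfl fun u _ => Real.mul_rpow ht.le (vwt_pos hG hx u).le
  have h3 : Real.sqrt (t ^ (Fintype.card V - 1) * treeSum G x) =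
      t ^ (((Fintype.card V : ℝ) - 1) / 2) * Real.sqrt (treeSum G x) := by
    rw [Real.sqrt_mul (pow_nonneg ht.le _), Real.sqrt_eq_rpow, ← Real.rpow_natCast,
      ← Real.rpow_mul ht.le, Nat.cast_sub Fintype.card_pos]
    congr 2
    push_cast
    ring
  have h4 : ∑ u, -(avwt G a u + 1) / 2 =
      -(∑ e : G.edgeSet, a (e : Sym2 V)) - (Fintype.card V : ℝ) / 2 := by
    have := sum_vwt (G := G) fun e => a e
    simp only [← avwt_eq_vwt] at this
    rw [← Finset.sum_div, Finset.sum_neg_distrib, Finset.sum_add_distrib, this]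
    simp
    ring
  have h5 : t ^ (∑ e : G.edgeSet, a (e : Sym2 V)) * t ^ (∑ u, -(avwt G a u + 1) / 2) *
      t ^ (((Fintype.card V : ℝ) - 1) / 2) * t ^ (1 / 2 : ℝ) = 1 := by
    rw [← Real.rpow_add ht, ← Real.rpow_add ht, ← Real.rpow_add ht, h4]
    convert! Real.rpow_zero t using 2
    ring
  rw [Phi_eq hG a v hx, Phi_eq hG a v fun e => mul_pos ht (hx e), PhiBase, PhiBase]
  simp only [vwt_smul, treeSum_smul]
  rw [h1, h2, h3, Real.sqrt_mul ht.le, Real.sqrt_eq_rpow t]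
  linear_combination ((∏ e : G.edgeSet, x e ^ a (e : Sym2 V)) *
    (∏ u, vwt G x u ^ (-(avwt G a u + 1) / 2)) * Real.sqrt (treeSum G x) *
    Real.sqrt (vwt G x v)) * h5

theorem Phi_eq_mul_exp_Hfun (hG : G.Connected) (a : Sym2 V → ℝ) (v₀ v₁ : V)
    {x : G.edgeSet → ℝ} (hx : ∀ e, 0 < x e) :
    Phi G a v₁ x = Phi G a v₀ x * Real.exp (2 * Hfun G v₀ v₁ x) := by
  have h0 := vwt_pos hG hx v₀
  have h1 := vwt_pos hG hx v₁
  have : Real.exp (2 * Hfun G v₀ v₁ x) = Real.sqrt (vwt G x v₁) / Real.sqrt (vwt G x v₀) := by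
    rw [← Real.sqrt_div h1.le, Real.sqrt_eq_rpow, Real.rpow_def_of_pos (div_pos h1 h0), Hfun]
    congr 1
    ring
  rw [this, Phi_eq hG a v₀ hx, Phi_eq hG a v₁ hx]
  have := (Real.sqrt_pos.2 h0).ne'
  field_simp

theorem abs_Hfun_mul_sqrt_le (hG : G.Connected) (a : Sym2 V → ℝ) (v₀ v₁ : V)
    {x : G.edgeSet → ℝ} (hx : ∀ e, 0 < x e) :
    |Hfun G v₀ v₁ x| * Real.sqrt (Phi G a v₀ x * Phi G a v₁ x) ≤
      Phi G a v₀ x + Phi G a v₁ x := by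
  have hp := Phi_pos hG a v₀ hx
  rw [Phi_eq_mul_exp_Hfun hG a v₀ v₁ hx]
  set h := Hfun G v₀ v₁ x
  have h2 : Real.exp (2 * h) = Real.exp h * Real.exp h := by rw [← Real.exp_add]; ring_nf
  have hs : Real.sqrt (Phi G a v₀ x * (Phi G a v₀ x * Real.exp (2 * h))) =
      Phi G a v₀ x * Real.exp h := by
    rw [h2, ← Real.sqrt_mul_self (mul_pos hp (Real.exp_pos h)).le]
    congr 1
    ring
  have hb : |h| * Real.exp h ≤ 1 + Real.exp (2 * h) := by
    have h3 : |h| ≤ Real.exp h + Real.exp (-h) := by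
      rw [abs_le]
      constructor <;>
      linarith [Real.add_one_le_exp h, Real.add_one_le_exp (-h), Real.exp_pos h,
        Real.exp_pos (-h)]
    have h4 : Real.exp (-h) * Real.exp h = 1 := by rw [← Real.exp_add]; simp
    nlinarith [mul_le_mul_of_nonneg_right h3 (Real.exp_pos h).le]
  rw [hs]
  nlinarith [mul_le_mul_of_nonneg_left hb hp.le]

end Weights

section Interpolation

variable {V : Type*} {G : SimpleGraph V} [Fintype G.edgeSet]

theorem measurable_treeSum : Measurable fun x : G.edgeSet → ℝ => treeSum G x := by
  unfold treeSum
  refine Finset.measurable_sum _ fun T _ => ?_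
  split_ifs <;> fun_prop

variable [DecidableEq V]

theorem measurable_vwt (v : V) : Measurable fun x : G.edgeSet → ℝ => vwt G x v := by
  unfold vwt
  refine Finset.measurable_sum _ fun e _ => ?_
  split_ifs <;> fun_prop

theorem measurable_Hfun (v₀ v₁ : V) : Measurable (Hfun G v₀ v₁) :=
  (((measurable_vwt v₁).div (measurable_vwt v₀)).log).const_mul _

theorem rho_eq_normMeasure (e₀ : G.edgeSet) : rho G e₀ = normMeasure e₀ := by
  unfold rho normMeasure
  congr!

variable [Fintype V]

theorem measurable_Phi (a : Sym2 V → ℝ) (v : V) : Measurable (Phi G a v) := by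
  unfold Phi
  refine ((Measurable.mul ?_ ((measurable_vwt v).pow_const _)).mul ?_).mul
    measurable_treeSum.sqrt
  · exact Finset.measurable_prod _ fun e _ => (measurable_pi_apply e).pow_const _
  · exact Finset.measurable_prod _ fun u _ => (measurable_vwt u).pow_const _

theorem measurable_interpDens (a : Sym2 V → ℝ) (v₀ v₁ : V) (e₀ : G.edgeSet) :
    Measurable (interpDens G a v₀ v₁ e₀) :=
  (((measurable_Phi a v₀).ennreal_ofReal.div_const _).mul
    ((measurable_Phi a v₁).ennreal_ofReal.div_const _)).pow_const _

theorem lintegral_Pm (a : Sym2 V → ℝ) (v₀ v₁ : V) (e₀ : G.edgeSet)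
    {h : (G.edgeSet → ℝ) → ℝ≥0∞} (hh : Measurable h) :
    ∫⁻ x, h x ∂Pm G a v₀ v₁ e₀ =
      (Zc G a v₀ v₁ e₀)⁻¹ * ∫⁻ x, h x * interpDens G a v₀ v₁ e₀ x ∂rho G e₀ := by
  rw [Pm, lintegral_smul_measure,
    lintegral_withDensity_eq_lintegral_mul _ (measurable_interpDens a v₀ v₁ e₀) hh, smul_eq_mul]
  simp only [Pi.mul_apply, mul_comm]

theorem ae_pos_Pm (a : Sym2 V → ℝ) (v₀ v₁ : V) (e₀ : G.edgeSet) :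
    ∀ᵐ x ∂Pm G a v₀ v₁ e₀, ∀ e, 0 < x e := by
  refine Measure.ae_smul_measure ?_ _
  refine (withDensity_absolutelyContinuous _ _) ?_
  rw [rho_eq_normMeasure]
  exact ae_pos_normMeasure e₀

variable [Nontrivial V]

theorem z_ne_zero (hG : G.Connected) (a : Sym2 V → ℝ) (v : V) (e₀ : G.edgeSet) :
    z G a v e₀ ≠ 0 := by
  intro h
  rw [z, rho_eq_normMeasure, lintegral_eq_zero_iff (measurable_Phi a v).ennreal_ofReal] at h
  refine normMeasure_ne_zero e₀ (ae_eq_bot.1 (Filter.eventually_false_iff_eq_bot.1 ?_))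
  filter_upwards [h, ae_pos_normMeasure e₀] with x h0 hx
  exact (ENNReal.ofReal_pos.2 (Phi_pos hG a v hx)).ne' h0

theorem interpDens_eq (hG : G.Connected) (a : Sym2 V → ℝ) (v₀ v₁ : V) (e₀ : G.edgeSet)
    {x : G.edgeSet → ℝ} (hx : ∀ e, 0 < x e) :
    interpDens G a v₀ v₁ e₀ x = ((z G a v₀ e₀)⁻¹ * (z G a v₁ e₀)⁻¹) ^ (1 / 2 : ℝ) *
      ENNReal.ofReal (Real.sqrt (Phi G a v₀ x * Phi G a v₁ x)) := by
  have h0 := (Phi_pos hG a v₀ hx).le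
  have h1 := (Phi_pos hG a v₁ hx).le
  rw [interpDens, Real.sqrt_eq_rpow,
    ← ENNReal.ofReal_rpow_of_nonneg (mul_nonneg h0 h1) (by norm_num),
    ← ENNReal.mul_rpow_of_nonneg _ _ (by norm_num), ENNReal.ofReal_mul h0,
    div_eq_mul_inv, div_eq_mul_inv]
  congr 1
  ring

theorem lintegral_mul_interpDens_ne_top (hG : G.Connected) {a : Sym2 V → ℝ} {v₀ v₁ : V}
    {e₀ : G.edgeSet} (hz0 : z G a v₀ e₀ ≠ ⊤) (hz1 : z G a v₁ e₀ ≠ ⊤)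
    {h : (G.edgeSet → ℝ) → ℝ}
    (hh : ∀ x, (∀ e, 0 < x e) → h x * Real.sqrt (Phi G a v₀ x * Phi G a v₁ x) ≤
      Phi G a v₀ x + Phi G a v₁ x) :
    ∫⁻ x, ENNReal.ofReal (h x) * interpDens G a v₀ v₁ e₀ x ∂rho G e₀ ≠ ⊤ := by
  set C : ℝ≥0∞ := ((z G a v₀ e₀)⁻¹ * (z G a v₁ e₀)⁻¹) ^ (1 / 2 : ℝ) with hC
  have hCtop : C ≠ ⊤ := ENNReal.rpow_ne_top_of_nonneg (by norm_num)
    (ENNReal.mul_ne_top (ENNReal.inv_ne_top.2 (z_ne_zero hG a v₀ e₀))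
      (ENNReal.inv_ne_top.2 (z_ne_zero hG a v₁ e₀)))
  have hle : ∫⁻ x, ENNReal.ofReal (h x) * interpDens G a v₀ v₁ e₀ x ∂rho G e₀ ≤
      ∫⁻ x, C * (ENNReal.ofReal (Phi G a v₀ x) + ENNReal.ofReal (Phi G a v₁ x)) ∂rho G e₀ := by
    refine lintegral_mono_ae ?_
    rw [rho_eq_normMeasure]
    filter_upwards [ae_pos_normMeasure e₀] with x hx
    rw [interpDens_eq hG a v₀ v₁ e₀ hx, ← hC, mul_left_comm,
      ← ENNReal.ofReal_mul' (Real.sqrt_nonneg _),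
      ← ENNReal.ofReal_add (Phi_pos hG a v₀ hx).le (Phi_pos hG a v₁ hx).le]
    gcongr
    exact hh x hx
  refine ne_top_of_le_ne_top ?_ hle
  rw [lintegral_const_mul' _ _ hCtop, lintegral_add_left (measurable_Phi a v₀).ennreal_ofReal]
  exact ENNReal.mul_ne_top hCtop (ENNReal.add_ne_top.2 ⟨hz0, hz1⟩)

theorem Zc_ne_top (hG : G.Connected) {a : Sym2 V → ℝ} {v₀ v₁ : V} {e₀ : G.edgeSet}
    (hz0 : z G a v₀ e₀ ≠ ⊤) (hz1 : z G a v₁ e₀ ≠ ⊤) : Zc G a v₀ v₁ e₀ ≠ ⊤ := by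
  have h := lintegral_mul_interpDens_ne_top hG hz0 hz1 (h := fun _ => 1) fun x hx => by
    have h0 := Phi_pos hG a v₀ hx
    have h1 := Phi_pos hG a v₁ hx
    rw [one_mul, Real.sqrt_le_left (add_pos h0 h1).le]
    nlinarith [mul_pos h0 h1]
  simpa [Zc] using h

theorem Zc_ne_zero (hG : G.Connected) {a : Sym2 V → ℝ} {v₀ v₁ : V} {e₀ : G.edgeSet}
    (hz0 : z G a v₀ e₀ ≠ ⊤) (hz1 : z G a v₁ e₀ ≠ ⊤) : Zc G a v₀ v₁ e₀ ≠ 0 := by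
  intro h
  rw [Zc, rho_eq_normMeasure, lintegral_eq_zero_iff (measurable_interpDens a v₀ v₁ e₀)] at h
  refine normMeasure_ne_zero e₀ (ae_eq_bot.1 (Filter.eventually_false_iff_eq_bot.1 ?_))
  filter_upwards [h, ae_pos_normMeasure e₀] with x h0 hx
  rw [interpDens_eq hG a v₀ v₁ e₀ hx] at h0
  have h1 := mul_pos (Phi_pos hG a v₀ hx) (Phi_pos hG a v₁ hx)
  have hz : (z G a v₀ e₀)⁻¹ * (z G a v₁ e₀)⁻¹ ≠ 0 :=
    mul_ne_zero (ENNReal.inv_ne_zero.2 hz0) (ENNReal.inv_ne_zero.2 hz1)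
  rcases mul_eq_zero.1 h0 with h2 | h2
  · exact hz ((ENNReal.rpow_eq_zero_iff_of_pos (by norm_num)).1 h2)
  · exact (ENNReal.ofReal_pos.2 (Real.sqrt_pos.2 h1)).ne' h2

theorem isProbabilityMeasure_Pm (hG : G.Connected) {a : Sym2 V → ℝ} {v₀ v₁ : V}
    {e₀ : G.edgeSet} (hz0 : z G a v₀ e₀ ≠ ⊤) (hz1 : z G a v₁ e₀ ≠ ⊤) :
    IsProbabilityMeasure (Pm G a v₀ v₁ e₀) := by
  constructor
  rw [← lintegral_one, lintegral_Pm _ _ _ _ measurable_const]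
  simp only [one_mul]
  exact ENNReal.inv_mul_cancel (Zc_ne_zero hG hz0 hz1) (Zc_ne_top hG hz0 hz1)

theorem integrable_Hfun (hG : G.Connected) {a : Sym2 V → ℝ} {v₀ v₁ : V}
    {e₀ : G.edgeSet} (hz0 : z G a v₀ e₀ ≠ ⊤) (hz1 : z G a v₁ e₀ ≠ ⊤) :
    Integrable (Hfun G v₀ v₁) (Pm G a v₀ v₁ e₀) := by
  refine ⟨(measurable_Hfun v₀ v₁).aestronglyMeasurable, ?_⟩
  rw [hasFiniteIntegral_iff_norm, lintegral_Pm _ _ _ _ (measurable_Hfun v₀ v₁).norm.ennreal_ofReal]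
  exact ENNReal.mul_lt_top (ENNReal.inv_lt_top.2 (Zc_ne_zero hG hz0 hz1).bot_lt)
    (lintegral_mul_interpDens_ne_top hG hz0 hz1
      fun x hx => abs_Hfun_mul_sqrt_le hG a v₀ v₁ hx).lt_top

theorem integral_Hfun_eq_zero (hG : G.Connected) {a : Sym2 V → ℝ} {v₀ v₁ : V}
    {e₀ : G.edgeSet} (hz0 : z G a v₀ e₀ ≠ ⊤) (hz1 : z G a v₁ e₀ ≠ ⊤) (ψ : G ≃g G)
    (ha : ∀ e : G.edgeSet, a (ψ.mapEdgeSet e) = a e) (h0 : ψ v₀ = v₁) (h1 : ψ v₁ = v₀) :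
    ∫ x, Hfun G v₀ v₁ x ∂Pm G a v₀ v₁ e₀ = 0 := by
  rw [integral_eq_lintegral_pos_part_sub_lintegral_neg_part (integrable_Hfun hG hz0 hz1),
    lintegral_Pm _ _ _ _ (measurable_Hfun v₀ v₁).ennreal_ofReal,
    lintegral_Pm _ _ _ _ (by exact (measurable_Hfun v₀ v₁).neg.ennreal_ofReal), sub_eq_zero]
  congr 2
  have hm : Measurable fun x =>
      ENNReal.ofReal (Hfun G v₀ v₁ x) * interpDens G a v₀ v₁ e₀ x :=
    (measurable_Hfun v₀ v₁).ennreal_ofReal.mul (measurable_interpDens a v₀ v₁ e₀)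
  rw [rho_eq_normMeasure, ← lintegral_normMeasure_comp hm ?_ ψ.mapEdgeSet e₀]
  · refine lintegral_congr_ae ?_
    filter_upwards [ae_pos_normMeasure e₀] with x hx
    have hx' : ∀ e, 0 < (x ∘ ψ.mapEdgeSet) e := fun e => hx _
    rw [interpDens_eq hG a v₀ v₁ e₀ hx, interpDens_eq hG a v₀ v₁ e₀ hx', Hfun_comp,
      Phi_comp ψ ha, Phi_comp ψ ha, h0, h1, Hfun_swap, mul_comm (Phi G a v₁ x)]
  · intro t ht x hx
    rw [Hfun_smul ht, interpDens, interpDens, Phi_smul hG a v₀ hx ht, Phi_smul hG a v₁ hx ht]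

end Interpolation

end ERRWGraph

open ERRWGraph in
/-- Lemma 5.7: under Assumption 2.3, for every `γ ∈ ℝ`,
`E_{Π^{γφ}}[H] = ∫ H(Ξ^{γφ}(x)) ℙ_{v₀,v₁,e₀}(dx) = γ/4`. -/
theorem deformed_H_mean {V : Type*} [Fintype V] [DecidableEq V]
    (G : SimpleGraph V) [Fintype G.edgeSet] (hG : G.Connected)
    (a φ : Sym2 V → ℝ) (ha : ∀ e ∈ G.edgeSet, 0 < a e)
    (v₀ v₁ : V) (e₀ : G.edgeSet)
    (hass : Assumption23 G a φ v₀ v₁ e₀)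
    (hz0 : z G a v₀ e₀ ≠ ⊤) (hz1 : z G a v₁ e₀ ≠ ⊤) (γ : ℝ) :
    (∫ x, Hfun G v₀ v₁ (Xi G φ γ x) ∂Pm G a v₀ v₁ e₀) = γ / 4 := by
  obtain ⟨hne, -, -, ⟨f, ⟨hf, hadj, hfa⟩, h0, h1⟩, -, hφ₀, hφ₁⟩ := hass
  have : Nontrivial V := ⟨v₀, v₁, hne⟩
  let ψ : G ≃g G := ⟨Equiv.ofBijective f hf, fun {u v} => hadj u v⟩
  have hψ : ∀ e : G.edgeSet, a (ψ.mapEdgeSet e) = a e := by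
    rintro ⟨e, he⟩
    induction e with
    | _ u v => exact hfa u v he
  have := isProbabilityMeasure_Pm hG hz0 hz1
  have hXi : (fun x => Hfun G v₀ v₁ (Xi G φ γ x)) =ᵐ[Pm G a v₀ v₁ e₀]
      fun x => γ / 4 + Hfun G v₀ v₁ x := by
    filter_upwards [ae_pos_Pm a v₀ v₁ e₀] with x hx
    exact Hfun_Xi hG hφ₀ hφ₁ γ hx
  rw [integral_congr_ae hXi,
    integral_add (integrable_const _) (integrable_Hfun hG hz0 hz1),
    integral_Hfun_eq_zero hG hz0 hz1 ψ hψ h0 h1]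
  simp
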